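/- (Asymptotic optimality of amplify-and-forward.) Let M, N be positive integers, G a 2×M complex matrix, H = [h₁ h₂] an N×2 complex matrix with det(H†H) > 0, and P_s > 0. For an M×M positive semidefinite Hermitian Q with tr(Q) ≤ P_s and a 2×2 matrix A = diag(a·e^{iφ}, b), define R_AF(Q, A) = log det( I_M + G Q G† · (I₂ − (I₂ + A†H†HA)^{-1}) ). For P > 0 define S(P) = sup of R_AF(Q, A) over all such Q, all φ ∈ ℝ, and all a, b with 0 ≤ a ≤ √(P / (1 + (GQG†)₁₁)) and 0 ≤ b ≤ √(P / (1 + (GQG†)₂₂)); and let C* = sup over positive semidefinite Q with tr(Q) ≤ P_s of log det(I_M + G Q G†). Then S(P) ≤ C* for all P > 0, and S(P) → C* as P → ∞. -/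

import Mathlib

open Matrix Complex Filter

/-- The `N × 2` matrix with columns `h₁` and `h₂`. -/
noncomputable def Hm {N : ℕ} (h₁ h₂ : Fin N → ℂ) : Matrix (Fin N) (Fin 2) ℂ :=
  Matrix.of fun i j => if j = 0 then h₁ i else h₂ i

/-- The Hermitian inner product `h₁† h₂ = ∑ i, conj (h₁ i) * h₂ i`. -/
noncomputable def ip {N : ℕ} (h₁ h₂ : Fin N → ℂ) : ℂ :=
  ∑ i, (starRingEnd ℂ) (h₁ i) * h₂ i

/-- The squared Euclidean norm `‖h‖²`. -/
noncomputable def nsq {N : ℕ} (h : Fin N → ℂ) : ℝ :=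
  ∑ i, Complex.normSq (h i)

/-- `det (H† H)`, a nonnegative real number (taken via the real part). -/
noncomputable def detHH {N : ℕ} (h₁ h₂ : Fin N → ℂ) : ℝ :=
  (((Hm h₁ h₂)ᴴ * Hm h₁ h₂).det).re

/-- The relay covariance matrix `Q_r(ρ)` with diagonal `P₁, P₂` and
off-diagonal `ρ √(P₁ P₂)`. -/
noncomputable def Qr (P₁ P₂ : ℝ) (ρ : ℂ) : Matrix (Fin 2) (Fin 2) ℂ :=
  !![(P₁ : ℂ), ρ * (Real.sqrt (P₁ * P₂) : ℂ);
     (starRingEnd ℂ) ρ * (Real.sqrt (P₁ * P₂) : ℂ), (P₂ : ℂ)]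

/-- `det (I_N + H Q_r(ρ) H†)` (a real number, taken via the real part). -/
noncomputable def MACdet {N : ℕ} (h₁ h₂ : Fin N → ℂ) (P₁ P₂ : ℝ) (ρ : ℂ) : ℝ :=
  ((1 + Hm h₁ h₂ * Qr P₁ P₂ ρ * (Hm h₁ h₂)ᴴ).det).re

open scoped ComplexOrder

/-- The amplify-and-forward rate `R_AF(Q, A) = log det(I₂ + G Q G† (I₂ − (I₂ + A†H†HA)⁻¹))`
(the determinant is real; it is taken via the real part). -/
noncomputable def rAF {M N : ℕ} (G : Matrix (Fin 2) (Fin M) ℂ)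
    (H : Matrix (Fin N) (Fin 2) ℂ) (Q : Matrix (Fin M) (Fin M) ℂ)
    (A : Matrix (Fin 2) (Fin 2) ℂ) : ℝ :=
  Real.log ((1 + G * Q * Gᴴ * (1 - (1 + Aᴴ * Hᴴ * H * A)⁻¹)).det).re

/-- `S(P)`: the supremum of `R_AF(Q, A)` over admissible source covariances `Q`
(positive semidefinite, `tr Q ≤ P_s`) and amplification matrices `A = diag(a e^{iφ}, b)`
with `0 ≤ a ≤ √(P/(1+(GQG†)₁₁))` and `0 ≤ b ≤ √(P/(1+(GQG†)₂₂))`. -/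
noncomputable def SAF {M N : ℕ} (G : Matrix (Fin 2) (Fin M) ℂ)
    (H : Matrix (Fin N) (Fin 2) ℂ) (Ps P : ℝ) : ℝ :=
  sSup {r : ℝ | ∃ (Q : Matrix (Fin M) (Fin M) ℂ) (a b φ : ℝ),
    Q.PosSemidef ∧ Q.trace.re ≤ Ps ∧
    0 ≤ a ∧ a ≤ Real.sqrt (P / (1 + ((G * Q * Gᴴ) 0 0).re)) ∧
    0 ≤ b ∧ b ≤ Real.sqrt (P / (1 + ((G * Q * Gᴴ) 1 1).re)) ∧
    r = rAF G H Q (Matrix.diagonal ![(a : ℂ) * Complex.exp (Complex.I * (φ : ℂ)), (b : ℂ)])}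

/-- `C* = sup {log det(I₂ + G Q G†) : Q PSD, tr Q ≤ P_s}`. -/
noncomputable def Cstar {M : ℕ} (G : Matrix (Fin 2) (Fin M) ℂ) (Ps : ℝ) : ℝ :=
  sSup {c : ℝ | ∃ Q : Matrix (Fin M) (Fin M) ℂ,
    Q.PosSemidef ∧ Q.trace.re ≤ Ps ∧ c = Real.log ((1 + G * Q * Gᴴ).det).re}

open scoped MatrixOrder in
lemma aux_factor {n : ℕ} {Q : Matrix (Fin n) (Fin n) ℂ} (h : Q.PosSemidef) :
    ∃ R : Matrix (Fin n) (Fin n) ℂ, Q = Rᴴ * R := by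
  obtain ⟨B, hB⟩ := CStarAlgebra.nonneg_iff_eq_star_mul_self.mp h.nonneg
  exact ⟨B, hB⟩

lemma aux_det_one_add (Z : Matrix (Fin 2) (Fin 2) ℂ) : (1 + Z).det = 1 + Z.trace + Z.det := by
  simp [Matrix.det_fin_two, Matrix.trace_fin_two]
  ring

lemma aux_one_le_det {Z : Matrix (Fin 2) (Fin 2) ℂ} (h : Z.PosSemidef) : 1 ≤ (1 + Z).det := by
  rw [aux_det_one_add, add_assoc]
  exact le_add_of_nonneg_right (add_nonneg h.trace_nonneg h.det_nonneg)

lemma aux_det_mono {X Y : Matrix (Fin 2) (Fin 2) ℂ} (hX : X.PosDef) (hY : Y.PosSemidef) :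
    X.det ≤ (X + Y).det := by
  obtain ⟨E, rfl⟩ := aux_factor hY
  have hu : IsUnit X.det := hX.det_pos.ne'.isUnit
  have h1 : X + Eᴴ * E = X * (1 + (X⁻¹ * Eᴴ) * E) := by
    rw [Matrix.mul_add, Matrix.mul_one, Matrix.mul_assoc, ← Matrix.mul_assoc X,
      Matrix.mul_nonsing_inv _ hu, Matrix.one_mul]
  rw [h1, Matrix.det_mul, Matrix.det_one_add_mul_comm, ← Matrix.mul_assoc]
  have h2 := aux_one_le_det (hX.inv.posSemidef.mul_mul_conjTranspose_same E)
  exact le_mul_of_one_le_right hX.det_pos.le h2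

lemma aux_D {B : Matrix (Fin 2) (Fin 2) ℂ} (hB : B.PosSemidef) :
    (1 - (1 + B)⁻¹).PosSemidef := by
  have hp : (1 + B).PosDef := Matrix.PosDef.one.add_posSemidef hB
  have hu : IsUnit (1 + B).det := hp.det_pos.ne'.isUnit
  have hT : ((1 + B)⁻¹)ᴴ = (1 + B)⁻¹ := hp.inv.isHermitian
  have h1 : (B + Bᴴ * B).PosSemidef := hB.add (Matrix.posSemidef_conjTranspose_mul_self B)
  have h2 := h1.mul_mul_conjTranspose_same ((1 + B)⁻¹)
  rw [hT] at h2
  have h3 : 1 - (1 + B)⁻¹ = (1 + B)⁻¹ * (B + Bᴴ * B) * (1 + B)⁻¹ := by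
    have e : B + Bᴴ * B = ((1 + B) - 1) * (1 + B) := by
      rw [hB.isHermitian.eq]; noncomm_ring
    rw [e, Matrix.mul_assoc, Matrix.mul_assoc, Matrix.mul_nonsing_inv _ hu, Matrix.mul_one,
      Matrix.mul_sub, Matrix.nonsing_inv_mul _ hu, Matrix.mul_one]
  rw [h3]; exact h2

lemma aux_rAF_le {W B : Matrix (Fin 2) (Fin 2) ℂ} (hW : W.PosSemidef) (hB : B.PosSemidef) :
    1 ≤ (1 + W * (1 - (1 + B)⁻¹)).det ∧ (1 + W * (1 - (1 + B)⁻¹)).det ≤ (1 + W).det := by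
  have hD := aux_D hB
  have hp : (1 + B).PosDef := Matrix.PosDef.one.add_posSemidef hB
  have hT := hp.inv.posSemidef
  set T := (1 + B)⁻¹ with hTdef
  obtain ⟨C, rfl⟩ := aux_factor hW
  have h1 : (1 + Cᴴ * C * (1 - T)).det = (1 + C * (1 - T) * Cᴴ).det := by
    rw [Matrix.mul_assoc, Matrix.det_one_add_mul_comm]
  have h2 : (1 + Cᴴ * C).det = ((1 + C * (1 - T) * Cᴴ) + C * T * Cᴴ).det := by
    rw [Matrix.det_one_add_mul_comm]
    congr 1; noncomm_ring
  have hDC := hD.mul_mul_conjTranspose_same C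
  rw [h1, h2]
  exact ⟨aux_one_le_det hDC, aux_det_mono (Matrix.PosDef.one.add_posSemidef hDC)
    (hT.mul_mul_conjTranspose_same C)⟩

section
attribute [local instance] Matrix.frobeniusSeminormedAddCommGroup

lemma aux_frob {m n : ℕ} (X : Matrix (Fin m) (Fin n) ℂ) :
    (X * Xᴴ).trace.re = ‖X‖ ^ 2 := by
  rw [Matrix.frobenius_norm_def, ← Real.sqrt_eq_rpow, Real.sq_sqrt (by positivity)]
  simp [Matrix.trace, Matrix.mul_apply, Complex.mul_conj, Complex.normSq_eq_norm_sq, -Complex.ofReal_pow]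

lemma aux_bound {M : ℕ} (G : Matrix (Fin 2) (Fin M) ℂ) (Ps : ℝ) :
    ∃ K : ℝ, ∀ Q : Matrix (Fin M) (Fin M) ℂ, Q.PosSemidef → Q.trace.re ≤ Ps →
      (G * Q * Gᴴ).trace.re ≤ K := by
  refine ⟨‖G‖ ^ 2 * Ps, fun Q hQ ht => ?_⟩
  obtain ⟨R, rfl⟩ := aux_factor hQ
  have e : G * (Rᴴ * R) * Gᴴ = (G * Rᴴ) * (G * Rᴴ)ᴴ := by
    simp [Matrix.mul_assoc]
  have e2 : (Rᴴ * R).trace.re = ‖Rᴴ‖ ^ 2 := by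
    rw [← aux_frob]; simp
  rw [e, aux_frob]
  have := Matrix.frobenius_norm_mul G Rᴴ
  calc ‖G * Rᴴ‖ ^ 2 ≤ (‖G‖ * ‖Rᴴ‖) ^ 2 := by gcongr
    _ = ‖G‖ ^ 2 * ‖Rᴴ‖ ^ 2 := by ring
    _ ≤ _ := by rw [← e2]; gcongr
end

lemma aux_re_one {z : ℂ} (h : 1 ≤ z) : 1 ≤ z.re := (Complex.le_def.mp h).1

lemma aux_det_le {W : Matrix (Fin 2) (Fin 2) ℂ} (hW : W.PosSemidef) :
    (1 + W).det.re ≤ (1 + W.trace.re) ^ 2 := by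
  have h0 := Complex.le_def.mp (hW.diag_nonneg (i := 0))
  have h1 := Complex.le_def.mp (hW.diag_nonneg (i := 1))
  have hh : W 1 0 = star (W 0 1) := by
    conv_lhs => rw [← hW.isHermitian.eq]
    rfl
  rw [aux_det_one_add, Matrix.det_fin_two, Matrix.trace_fin_two, hh]
  simp at h0 h1 ⊢
  rw [← h0.2, ← h1.2]
  nlinarith [mul_nonneg h0.1 h1.1, sq_nonneg (W 0 1).re, sq_nonneg (W 0 1).im,
    sq_nonneg (W 0 0).re, sq_nonneg (W 1 1).re]

lemma aux_bdd {M : ℕ} (G : Matrix (Fin 2) (Fin M) ℂ) (Ps : ℝ) :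
    BddAbove {c : ℝ | ∃ Q : Matrix (Fin M) (Fin M) ℂ,
      Q.PosSemidef ∧ Q.trace.re ≤ Ps ∧ c = Real.log ((1 + G * Q * Gᴴ).det).re} := by
  obtain ⟨K, hK⟩ := aux_bound G Ps
  refine ⟨(1 + K) ^ 2, ?_⟩
  rintro c ⟨Q, hQ, ht, rfl⟩
  have hW := hQ.mul_mul_conjTranspose_same G
  have h1 := aux_re_one (aux_one_le_det hW)
  have h2 := aux_det_le hW
  have h3 := hK Q hQ ht
  have h4 := (Complex.le_def.mp hW.trace_nonneg).1
  simp only [Complex.zero_re] at h4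
  have h5 := Real.log_le_sub_one_of_pos (zero_lt_one.trans_le h1)
  have h6 : (1 + (G * Q * Gᴴ).trace.re) ^ 2 ≤ (1 + K) ^ 2 := by gcongr
  linarith

lemma aux_B_psd {N : ℕ} (H : Matrix (Fin N) (Fin 2) ℂ) (A : Matrix (Fin 2) (Fin 2) ℂ) :
    (Aᴴ * Hᴴ * H * A).PosSemidef := by
  have := Matrix.posSemidef_conjTranspose_mul_self (H * A)
  simpa [Matrix.mul_assoc] using this

lemma aux_le {M N : ℕ} (G : Matrix (Fin 2) (Fin M) ℂ) (H : Matrix (Fin N) (Fin 2) ℂ)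
    (Q : Matrix (Fin M) (Fin M) ℂ) (A : Matrix (Fin 2) (Fin 2) ℂ) (hQ : Q.PosSemidef) :
    rAF G H Q A ≤ Real.log ((1 + G * Q * Gᴴ).det).re := by
  obtain ⟨h1, h2⟩ := aux_rAF_le (hQ.mul_mul_conjTranspose_same G) (aux_B_psd H A)
  exact Real.log_le_log (by linarith [aux_re_one h1]) (Complex.le_def.mp h2).1

lemma aux_inv_tendsto {B : Matrix (Fin 2) (Fin 2) ℂ} (hB : B.det ≠ 0) :
    Tendsto (fun P : ℝ => (1 + (P : ℂ) • B)⁻¹) atTop (nhds 0) := by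
  have h0 : Tendsto (fun P : ℝ => ((P⁻¹ : ℝ) : ℂ)) atTop (nhds 0) := by
    have := (Complex.continuous_ofReal.tendsto 0).comp tendsto_inv_atTop_zero
    rw [Complex.ofReal_zero] at this
    exact this
  have h1 : Tendsto (fun P : ℝ => ((P⁻¹ : ℝ) : ℂ) • (1 : Matrix (Fin 2) (Fin 2) ℂ) + B) atTop
      (nhds B) := by
    have := (h0.smul_const (1 : Matrix (Fin 2) (Fin 2) ℂ)).add_const B
    simpa using this
  have hc : ContinuousAt Inv.inv B := by
    apply continuousAt_matrix_inv
    rw [show (Ring.inverse : ℂ → ℂ) = Inv.inv from funext fun x => Ring.inverse_eq_inv x]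
    exact continuousAt_inv₀ hB
  have h2 := h0.smul (hc.tendsto.comp h1)
  rw [zero_smul] at h2
  have hd : ∀ᶠ P : ℝ in atTop,
      (((P⁻¹ : ℝ) : ℂ) • (1 : Matrix (Fin 2) (Fin 2) ℂ) + B).det ≠ 0 :=
    (((continuous_id.matrix_det.tendsto B).comp h1)).eventually_ne hB
  refine h2.congr' ?_
  filter_upwards [hd, eventually_gt_atTop 0] with P hP hP0
  symm
  apply Matrix.inv_eq_right_inv
  have hPc : (P : ℂ) ≠ 0 := by exact_mod_cast hP0.ne'
  have e : 1 + (P : ℂ) • B = (P : ℂ) • (((P⁻¹ : ℝ) : ℂ) • (1 : Matrix (Fin 2) (Fin 2) ℂ) + B) := by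
    rw [smul_add, smul_smul]; push_cast; rw [mul_inv_cancel₀ hPc, one_smul]
  rw [e, Matrix.smul_mul, Function.comp_apply, Matrix.mul_smul,
    Matrix.mul_nonsing_inv _ hP.isUnit, smul_smul]
  push_cast; rw [mul_inv_cancel₀ hPc, one_smul]

lemma aux_tendsto {M N : ℕ} (G : Matrix (Fin 2) (Fin M) ℂ) (H : Matrix (Fin N) (Fin 2) ℂ)
    (hH : (Hᴴ * H).det ≠ 0) (Q : Matrix (Fin M) (Fin M) ℂ) (hQ : Q.PosSemidef)
    (u v : ℝ) (hu : 0 < u) (hv : 0 < v) :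
    Tendsto (fun P : ℝ => rAF G H Q (Matrix.diagonal
      ![((Real.sqrt (P / u) : ℝ) : ℂ) * Complex.exp (Complex.I * ((0 : ℝ) : ℂ)),
        ((Real.sqrt (P / v) : ℝ) : ℂ)])) atTop
      (nhds (Real.log ((1 + G * Q * Gᴴ).det).re)) := by
  set E : Matrix (Fin 2) (Fin 2) ℂ :=
    Matrix.diagonal ![((Real.sqrt (1 / u) : ℝ) : ℂ), ((Real.sqrt (1 / v) : ℝ) : ℂ)] with hE
  have hEd : E.det ≠ 0 := by
    have h1 : Real.sqrt (1 / u) ≠ 0 := (Real.sqrt_pos.mpr (by positivity)).ne'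
    have h2 : Real.sqrt (1 / v) ≠ 0 := (Real.sqrt_pos.mpr (by positivity)).ne'
    rw [hE, Matrix.det_diagonal, Fin.prod_univ_two]
    exact mul_ne_zero (Complex.ofReal_ne_zero.mpr h1) (Complex.ofReal_ne_zero.mpr h2)
  have hBd : (Eᴴ * (Hᴴ * H) * E).det ≠ 0 := by
    rw [Matrix.det_mul, Matrix.det_mul, Matrix.det_conjTranspose]
    exact mul_ne_zero (mul_ne_zero (star_ne_zero.mpr hEd) hH) hEd
  have ht := aux_inv_tendsto hBd
  have hcont : Continuous fun T : Matrix (Fin 2) (Fin 2) ℂ =>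
      ((1 + G * Q * Gᴴ * (1 - T)).det).re := by
    apply Complex.continuous_re.comp
    apply Continuous.matrix_det
    fun_prop
  have h2 := (hcont.tendsto 0).comp ht
  simp only [sub_zero, Matrix.mul_one] at h2
  have hpos : ((1 + G * Q * Gᴴ).det).re ≠ 0 := by
    have := aux_re_one (aux_one_le_det (hQ.mul_mul_conjTranspose_same G))
    linarith
  refine (h2.log hpos).congr' ?_
  filter_upwards [eventually_gt_atTop 0] with P hP
  have hA : (Matrix.diagonal
      ![((Real.sqrt (P / u) : ℝ) : ℂ) * Complex.exp (Complex.I * ((0 : ℝ) : ℂ)),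
        ((Real.sqrt (P / v) : ℝ) : ℂ)]) = ((Real.sqrt P : ℝ) : ℂ) • E := by
    rw [hE, ← Matrix.diagonal_smul]
    congr 1
    have e : ∀ w : ℝ, Real.sqrt (P / w) = Real.sqrt P * Real.sqrt (1 / w) := fun w => by
      rw [← Real.sqrt_mul hP.le, mul_one_div]
    ext i
    fin_cases i
    · simp [e]
    · simp [e]
  have hs : ((Real.sqrt P : ℝ) : ℂ) * ((Real.sqrt P : ℝ) : ℂ) = (P : ℂ) := by
    exact_mod_cast Real.mul_self_sqrt hP.le
  rw [hA, rAF]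
  have hB : (((Real.sqrt P : ℝ) : ℂ) • E)ᴴ * Hᴴ * H * (((Real.sqrt P : ℝ) : ℂ) • E)
      = (P : ℂ) • (Eᴴ * (Hᴴ * H) * E) := by
    rw [Matrix.conjTranspose_smul]
    simp only [Matrix.smul_mul, Matrix.mul_smul, smul_smul, Complex.star_def, Complex.conj_ofReal,
      Matrix.mul_assoc, hs]
  rw [hB]
  rfl

/-- Asymptotic optimality of amplify-and-forward. If `det(H†H) > 0`
and `P_s > 0`, then `S(P) ≤ C*` for every `P > 0` and `S(P) → C*` as `P → ∞`. -/
theorem stmt15 {M N : ℕ} (hM : 0 < M) (hN : 0 < N)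
    (G : Matrix (Fin 2) (Fin M) ℂ) (h₁ h₂ : Fin N → ℂ) (Ps : ℝ) (hPs : 0 < Ps)
    (hH : 0 < detHH h₁ h₂) :
    (∀ P : ℝ, 0 < P → SAF G (Hm h₁ h₂) Ps P ≤ Cstar G Ps) ∧
    Filter.Tendsto (fun P => SAF G (Hm h₁ h₂) Ps P) Filter.atTop
      (nhds (Cstar G Ps)) := by
  have hdet : ((Hm h₁ h₂)ᴴ * Hm h₁ h₂).det ≠ 0 := by
    intro h
    simp [detHH, h] at hH
  have hbdd := aux_bdd G Ps
  have hub : ∀ P : ℝ, ∀ r ∈ {r : ℝ | ∃ (Q : Matrix (Fin M) (Fin M) ℂ) (a b φ : ℝ),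
      Q.PosSemidef ∧ Q.trace.re ≤ Ps ∧
      0 ≤ a ∧ a ≤ Real.sqrt (P / (1 + ((G * Q * Gᴴ) 0 0).re)) ∧
      0 ≤ b ∧ b ≤ Real.sqrt (P / (1 + ((G * Q * Gᴴ) 1 1).re)) ∧
      r = rAF G (Hm h₁ h₂) Q
        (Matrix.diagonal ![(a : ℂ) * Complex.exp (Complex.I * (φ : ℂ)), (b : ℂ)])},
      r ≤ Cstar G Ps := by
    rintro P r ⟨Q, a, b, φ, hQ, ht, -, -, -, -, rfl⟩
    exact (aux_le G _ Q _ hQ).trans (le_csSup hbdd ⟨Q, hQ, ht, rfl⟩)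
  have hle : ∀ P : ℝ, SAF G (Hm h₁ h₂) Ps P ≤ Cstar G Ps := by
    intro P
    refine csSup_le ?_ (hub P)
    exact ⟨_, 0, 0, 0, 0, Matrix.PosSemidef.zero, by simpa using hPs.le, le_rfl,
      Real.sqrt_nonneg _, le_rfl, Real.sqrt_nonneg _, rfl⟩
  refine ⟨fun P _ => hle P, ?_⟩
  rw [tendsto_order]
  refine ⟨fun c hc => ?_, fun c hc => Eventually.of_forall fun P => (hle P).trans_lt hc⟩
  have hne : {c : ℝ | ∃ Q : Matrix (Fin M) (Fin M) ℂ,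
      Q.PosSemidef ∧ Q.trace.re ≤ Ps ∧ c = Real.log ((1 + G * Q * Gᴴ).det).re}.Nonempty :=
    ⟨_, 0, Matrix.PosSemidef.zero, by simpa using hPs.le, rfl⟩
  obtain ⟨_, ⟨Q, hQ, ht, rfl⟩, hlt⟩ := exists_lt_of_lt_csSup hne hc
  have hW := hQ.mul_mul_conjTranspose_same G
  have d0 := (Complex.le_def.mp (hW.diag_nonneg (i := 0))).1
  have d1 := (Complex.le_def.mp (hW.diag_nonneg (i := 1))).1
  simp only [Complex.zero_re] at d0 d1
  have htend := aux_tendsto G (Hm h₁ h₂) hdet Q hQ (1 + ((G * Q * Gᴴ) 0 0).re)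
    (1 + ((G * Q * Gᴴ) 1 1).re) (by linarith) (by linarith)
  filter_upwards [htend.eventually_const_lt hlt] with P hP
  refine hP.trans_le (le_csSup ⟨_, hub P⟩ ?_)
  exact ⟨Q, _, _, 0, hQ, ht, Real.sqrt_nonneg _, le_rfl, Real.sqrt_nonneg _, le_rfl, rfl⟩
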